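/- For every z ∈ ℝ and every k ∈ ℤ with |k| ≥ 2, the function x ↦ x²·J_{x+k}(z)·J_{x-k}(z) is summable over ℤ and ∑_{x ∈ ℤ} x²·J_{x+k}(z)·J_{x-k}(z) = 0. -/

import Mathlib

open scoped Real

/-- Bessel function of the first kind of integer order `n`:
`J_n(x) = (1/π) ∫₀^π cos (n τ - x sin τ) dτ`. -/
noncomputable def besselJ (n : ℤ) (x : ℝ) : ℝ :=
  (1 / Real.pi) * ∫ τ in (0 : ℝ)..Real.pi, Real.cos (n * τ - x * Real.sin τ)

lemma bessel_rec (n : ℤ) (z : ℝ) :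
    (n : ℝ) * besselJ n z = z / 2 * (besselJ (n - 1) z + besselJ (n + 1) z) := by
  have hint : ∀ m : ℤ, IntervalIntegrable (fun τ : ℝ => Real.cos (m * τ - z * Real.sin τ))
      MeasureTheory.volume 0 Real.pi := fun m =>
    Continuous.intervalIntegrable (by fun_prop) _ _
  have h0 : ∫ τ in (0 : ℝ)..Real.pi,
      (n - z * Real.cos τ) * Real.cos (n * τ - z * Real.sin τ) = 0 := by
    have := intervalIntegral.integral_eq_sub_of_hasDerivAt (a := 0) (b := Real.pi)
      (f := fun τ : ℝ => Real.sin (n * τ - z * Real.sin τ))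
      (f' := fun τ : ℝ => (n - z * Real.cos τ) * Real.cos (n * τ - z * Real.sin τ))
      (fun x _ => by
        have h1 : HasDerivAt (fun τ : ℝ => n * τ - z * Real.sin τ) (n * 1 - z * Real.cos x) x :=
          ((hasDerivAt_id x).const_mul (n : ℝ)).sub ((Real.hasDerivAt_sin x).const_mul z)
        have h2 := h1.sin
        exact h2.congr_deriv (by ring))
      (Continuous.intervalIntegrable (by fun_prop) _ _)
    rw [this]
    simp [Real.sin_int_mul_pi]
  have h1 : ∫ τ in (0 : ℝ)..Real.pi,
      (n - z * Real.cos τ) * Real.cos (n * τ - z * Real.sin τ) =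
      ∫ τ in (0 : ℝ)..Real.pi, ((n : ℝ) * Real.cos (n * τ - z * Real.sin τ)
        - z / 2 * (Real.cos ((n - 1 : ℤ) * τ - z * Real.sin τ)
          + Real.cos ((n + 1 : ℤ) * τ - z * Real.sin τ))) := by
    congr 1
    ext τ
    have e1 : ((n - 1 : ℤ) : ℝ) * τ - z * Real.sin τ = (n * τ - z * Real.sin τ) - τ := by
      push_cast; ring
    have e2 : ((n + 1 : ℤ) : ℝ) * τ - z * Real.sin τ = (n * τ - z * Real.sin τ) + τ := by
      push_cast; ring
    rw [e1, e2, Real.cos_sub _ τ, Real.cos_add _ τ]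
    ring
  rw [h1, intervalIntegral.integral_sub ((hint n).const_mul _)
    (((hint _).add (hint _)).const_mul _), intervalIntegral.integral_const_mul,
    intervalIntegral.integral_const_mul, intervalIntegral.integral_add (hint _) (hint _)] at h0
  unfold besselJ
  linear_combination (1 / Real.pi) * h0

instance besselFact : Fact (0 < 2 * Real.pi) := ⟨Real.two_pi_pos⟩

/-- generating function times a character -/
noncomputable def besselF (z : ℝ) (a : ℤ) : C(AddCircle (2 * Real.pi), ℂ) :=
  ⟨fun x => fourier (-a) x * Complex.exp (z / 2 * (fourier 1 x - fourier (-1) x)), by fun_prop⟩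

lemma besselF_coe (z : ℝ) (a : ℤ) (τ : ℝ) :
    besselF z a (τ : AddCircle (2 * Real.pi)) =
      Complex.exp (-(a * τ - z * Real.sin τ : ℝ) * Complex.I) := by
  have hpi : (Real.pi : ℂ) ≠ 0 := by exact_mod_cast Real.pi_ne_zero
  have key : ∀ m : ℤ, fourier m (τ : AddCircle (2 * Real.pi)) = Complex.exp ((m * τ) * Complex.I) := by
    intro m
    rw [fourier_coe_apply]
    congr 1
    push_cast
    field_simp
  simp only [besselF, ContinuousMap.coe_mk, key]
  rw [← Complex.exp_add]
  congr 1
  have e1 : ((1 : ℤ) : ℂ) * τ * Complex.I = τ * Complex.I := by simp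
  have e2 : ((-1 : ℤ) : ℂ) * τ * Complex.I = (-τ : ℂ) * Complex.I := by simp
  rw [e1, e2, Complex.exp_mul_I, Complex.exp_mul_I, Complex.cos_neg, Complex.sin_neg]
  push_cast
  ring

lemma besselF_coeff (z : ℝ) (a n : ℤ) :
    fourierCoeff (besselF z a) n = (besselJ (n + a) z : ℂ) := by
  have hpi : (Real.pi : ℂ) ≠ 0 := by exact_mod_cast Real.pi_ne_zero
  rw [fourierCoeff_eq_intervalIntegral _ _ (-Real.pi)]
  have e : -Real.pi + 2 * Real.pi = Real.pi := by ring
  set g : ℝ → ℂ := fun τ => Complex.exp (-((n + a : ℤ) * τ - z * Real.sin τ : ℝ) * Complex.I) with hg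
  have hgc : Continuous g := by rw [hg]; fun_prop
  have hfg : ∀ τ : ℝ, fourier (-n) (τ : AddCircle (2 * Real.pi)) • besselF z a τ = g τ := by
    intro τ
    rw [besselF_coe, fourier_coe_apply, smul_eq_mul, ← Complex.exp_add]
    simp only [hg]
    congr 1
    push_cast
    field_simp
    ring
  simp_rw [hfg]
  rw [e, ← intervalIntegral.integral_add_adjacent_intervals (b := 0)
    (hgc.intervalIntegrable _ _) (hgc.intervalIntegrable _ _)]
  have h2 : ∫ τ in (-Real.pi)..0, g τ = ∫ τ in (0:ℝ)..Real.pi, g (-τ) := by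
    rw [intervalIntegral.integral_comp_neg]; simp
  rw [h2, ← intervalIntegral.integral_add
    (f := fun τ => g (-τ))
    ((hgc.comp continuous_neg).intervalIntegrable _ _) (hgc.intervalIntegrable _ _)]
  have h3 : ∀ τ : ℝ, g (-τ) + g τ =
      ((2 * Real.cos ((n + a : ℤ) * τ - z * Real.sin τ) : ℝ) : ℂ) := by
    intro τ
    simp only [hg]
    have e1 : (-((((n + a : ℤ) : ℝ) * (-τ) - z * Real.sin (-τ) : ℝ) : ℂ)) =
        (((n + a : ℤ) * τ - z * Real.sin τ : ℝ) : ℂ) := by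
      rw [Real.sin_neg]; push_cast; ring
    rw [e1, Complex.ofReal_mul, Complex.ofReal_cos, Complex.ofReal_ofNat, Complex.two_cos]
  simp_rw [h3]
  rw [intervalIntegral.integral_ofReal, intervalIntegral.integral_const_mul]
  unfold besselJ
  rw [Complex.real_smul, ← Complex.ofReal_mul]
  congr 1
  field_simp

lemma bessel_orth (z : ℝ) (a b : ℤ) (hab : a ≠ b) :
    HasSum (fun x : ℤ => besselJ (x + a) z * besselJ (x + b) z) 0 := by
  let L : ℤ → MeasureTheory.Lp ℂ 2 (@AddCircle.haarAddCircle (2 * Real.pi) _) := fun c =>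
    ContinuousMap.toLp 2 AddCircle.haarAddCircle ℂ (besselF z c)
  have h := (fourierBasis (T := 2 * Real.pi)).hasSum_inner_mul_inner (L a) (L b)
  have hin : inner ℂ (L a) (L b) = 0 := by
    have : inner ℂ (L a) (L b) = fourierCoeff (T := 2 * Real.pi) (fourier 0 : C(AddCircle (2 * Real.pi), ℂ)) (b - a) := by
      simp only [L]
      rw [MeasureTheory.ContinuousMap.inner_toLp]
      unfold fourierCoeff
      congr 1
      ext x
      induction x using QuotientAddGroup.induction_on with
      | H τ =>
        have hpi : (Real.pi : ℂ) ≠ 0 := by exact_mod_cast Real.pi_ne_zero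
        have ha := besselF_coe z a τ
        have hb := besselF_coe z b τ
        have hf := fourier_coe_apply (T := 2 * Real.pi) (n := -(b - a)) (x := τ)
        change besselF z b (τ : AddCircle (2 * Real.pi)) *
          (starRingEnd ℂ) (besselF z a (τ : AddCircle (2 * Real.pi))) =
          fourier (-(b - a)) (τ : AddCircle (2 * Real.pi)) •
            fourier 0 (τ : AddCircle (2 * Real.pi))
        rw [ha, hb, hf, fourier_zero, smul_eq_mul, mul_one, ← Complex.exp_conj,
          ← Complex.exp_add]
        congr 1
        rw [map_mul, map_neg, Complex.conj_ofReal, Complex.conj_I]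
        push_cast
        field_simp
        ring
    rw [this, fourierCoeff_fourier]
    simp [sub_eq_zero, hab.symm]
  rw [hin] at h
  have hc : ∀ c x : ℤ, inner ℂ (fourierBasis (T := 2 * Real.pi) x) (L c) = (besselJ (x + c) z : ℂ) := by
    intro c x
    rw [← HilbertBasis.repr_apply_apply, fourierBasis_repr, fourierCoeff_toLp, besselF_coeff]
  have hc' : ∀ c x : ℤ, inner ℂ (L c) (fourierBasis (T := 2 * Real.pi) x) = (besselJ (x + c) z : ℂ) := by
    intro c x
    rw [← inner_conj_symm, hc, Complex.conj_ofReal]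
  simp only [hc, hc'] at h
  rw [← Complex.hasSum_ofReal]
  simpa using h

/-- For `|k| ≥ 2` the cross term contributes nothing to the second moment:
`∑_{x ∈ ℤ} x² J_{x+k}(z) J_{x-k}(z) = 0`. -/
theorem cross_term_second_moment (z : ℝ) (k : ℤ) (hk : 2 ≤ |k|) :
    Summable (fun x : ℤ => (x : ℝ) ^ 2 * besselJ (x + k) z * besselJ (x - k) z) ∧
    ∑' x : ℤ, (x : ℝ) ^ 2 * besselJ (x + k) z * besselJ (x - k) z = 0 := by
  suffices h : HasSum (fun x : ℤ => (x : ℝ) ^ 2 * besselJ (x + k) z * besselJ (x - k) z) 0 from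
    ⟨h.summable, h.tsum_eq⟩
  have hk' : 2 ≤ k ∨ k ≤ -2 := by
    rcases le_abs.mp hk with h | h
    · exact Or.inl h
    · right; omega
  have h0 := bessel_orth z k (-k) (by omega)
  have h1 := bessel_orth z (k - 1) (-k - 1) (by omega)
  have h2 := bessel_orth z (k - 1) (-k + 1) (by omega)
  have h3 := bessel_orth z (k + 1) (-k - 1) (by omega)
  have h4 := bessel_orth z (k + 1) (-k + 1) (by omega)
  have h := (h0.mul_left ((k : ℝ) ^ 2)).add
    ((((h1.add h2).add h3).add h4).mul_left (z ^ 2 / 4))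
  simp only [mul_zero, add_zero] at h
  refine (congrArg (fun f : ℤ → ℝ => HasSum f 0) (funext fun x => ?_)).mpr h
  have r1 := bessel_rec (x + k) z
  have r2 := bessel_rec (x - k) z
  push_cast at r1 r2
  have e1 : x + (k - 1) = x + k - 1 := by ring
  have e2 : x + (k + 1) = x + k + 1 := by ring
  have e3 : x + (-k - 1) = x - k - 1 := by ring
  have e4 : x + (-k + 1) = x - k + 1 := by ring
  have e5 : x + (-k) = x - k := by ring
  rw [e1, e2, e3, e4, e5]
  have r3 := congrArg₂ (· * ·) r1 r2
  linear_combination r3
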